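/- Existence and uniqueness of the dual KP times. Let p and q be coprime positive integers and let t_1,...,t_{p+q} ∈ ℂ with t_{p+q} = p/(p+q). Then there exist unique complex numbers t̂_1,...,t̂_{p+q−1} such that, setting t̂_{p+q} := −q/(p+q) and defining F_1(v) = (1/p)·Σ_{k=1}^{p+q} k·t_k·v^{k−p} ∈ ℂ((1/v)) and F_2(w) = −(1/q)·Σ_{k=1}^{p+q} k·t̂_k·w^{k−q} ∈ ℂ((1/w)), the following holds: there exist a series R ∈ v^{−p}·ℂ[[1/v]] and a series Y = v·(1 + Σ_{n≥1} y_n v^{−n}) with Y^q = F_1 + R and F_2∘Y = v^p (i.e., the compositional inverse of f_2 equals f_1 up to a gauge term in s^{−1}ℂ[[s^{−1/p}]]). -/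

import Mathlib

/- STATEMENT 10: existence and uniqueness of the dual KP times.  Given coprime
positive `p, q` and times `t_1,…,t_{p+q}` with `t_{p+q} = p/(p+q)`, there are
unique `t̂_1,…,t̂_{p+q-1}` such that, with `t̂_{p+q} = -q/(p+q)`, the inverse of
`f₂` equals `f₁` up to a gauge term in `s^{-1}ℂ[[s^{-1/p}]]`.

`ℂ((1/v))` is encoded as `LaurentSeries ℂ` in `X = 1/v`; `F₁(v) = f₁(v^p)` and
`F₂(w) = f₂(w^q)` encode the fractional series; `CompEq F g H` means `H = F∘g`. -/

open scoped Classical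
noncomputable section

abbrev LS : Type := LaurentSeries ℂ

/-- The element `v = X⁻¹`. -/
def zz : LS := HahnSeries.single (-1 : ℤ) (1 : ℂ)

/-- `1 + ∑_{n≥1} c n X^n` as a power series. -/
def onePlusP (c : ℕ → ℂ) : PowerSeries ℂ := PowerSeries.mk fun n => if n = 0 then 1 else c n

/-- `1 + ∑_{n≥1} c n v^{-n}` as an element of `ℂ((1/v))`. -/
def onePlusL (c : ℕ → ℂ) : LS := HahnSeries.ofPowerSeries ℤ ℂ (onePlusP c)

/-- `v·(1 + ∑_{n≥1} c n v^{-n})`. -/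
def zSeries (c : ℕ → ℂ) : LS := zz * onePlusL c

/-- `H = F ∘ g`. -/
def CompEq (F g H : LS) : Prop :=
  ∀ k : ℤ, H.coeff k = ∑ᶠ m : ℤ, F.coeff m * (g ^ (-m)).coeff k

/-- `R ∈ v^{-p}·ℂ[[1/v]]`: in `X`-exponents, `R.coeff m = 0` for `m < p`. -/
def GaugeAt (p : ℕ) (R : LS) : Prop := ∀ m : ℤ, m < (p : ℤ) → R.coeff m = 0

/-- `F₁(v) = (1/p)·∑_{k=1}^{p+q} k t_k v^{k-p}`. -/
def Fone (p q : ℕ) (t : ℕ → ℂ) : LS :=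
  ∑ k ∈ Finset.Icc 1 (p + q), (((k : ℂ) * t k) / (p : ℂ)) • zz ^ ((k : ℤ) - (p : ℤ))

/-- `F₂(w) = -(1/q)·∑_{k=1}^{p+q} k t̂_k w^{k-q}`. -/
def Ftwo (p q : ℕ) (th : ℕ → ℂ) : LS :=
  -∑ k ∈ Finset.Icc 1 (p + q), (((k : ℂ) * th k) / (q : ℂ)) • zz ^ ((k : ℤ) - (q : ℤ))

section FormalPowerSeries

variable {K : Type*} [Field K]

open PowerSeries

/-- Near a simple approximate root, a polynomial over `K⟦X⟧` separates points `X`-adically. -/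
theorem PowerSeries.X_pow_dvd_sub_of_eval (P : Polynomial K⟦X⟧) {a b : K⟦X⟧} {n : ℕ}
    (hab : (X : K⟦X⟧) ∣ a - b) (hb : constantCoeff (P.derivative.eval b) ≠ 0)
    (h : (X : K⟦X⟧) ^ n ∣ P.eval a - P.eval b) : (X : K⟦X⟧) ^ n ∣ a - b := by
  obtain ⟨k, hk⟩ := P.binomExpansion b (a - b)
  have hu : IsUnit (P.derivative.eval b + k * (a - b)) := by
    rw [PowerSeries.isUnit_iff_constantCoeff, map_add, map_mul, X_dvd_iff.1 hab]
    simpa using hb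
  rw [add_sub_cancel] at hk
  rw [← hu.dvd_mul_left]
  convert h using 1
  rw [hk]
  ring

/-- Hensel's lemma for `K⟦X⟧`, with control of the precision. -/
theorem PowerSeries.exists_eval_eq_zero (P : Polynomial K⟦X⟧) (hP : P.Monic) {b : K⟦X⟧} {n : ℕ}
    (hn : n ≠ 0) (hb : constantCoeff (P.derivative.eval b) ≠ 0)
    (h : (X : K⟦X⟧) ^ n ∣ P.eval b) : ∃ a, P.eval a = 0 ∧ (X : K⟦X⟧) ^ n ∣ a - b := by
  obtain ⟨a, ha, hab⟩ := HenselianRing.is_henselian (I := Ideal.span {(X : K⟦X⟧)}) P hP b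
    (Ideal.mem_span_singleton.2 ((dvd_pow_self X hn).trans h))
    (((PowerSeries.isUnit_iff_constantCoeff).2 hb.isUnit).map _)
  refine ⟨a, ha, X_pow_dvd_sub_of_eval P (Ideal.mem_span_singleton.1 hab) hb ?_⟩
  rw [ha.eq_zero]
  simpa using h

/-- Every power series with constant coefficient `1` has a `q`-th root of the same kind. -/
theorem PowerSeries.exists_pow_eq [CharZero K] {q : ℕ} (hq : q ≠ 0) {D : K⟦X⟧}
    (hD : constantCoeff D = 1) : ∃ U : K⟦X⟧, constantCoeff U = 1 ∧ U ^ q = D := by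
  obtain ⟨U, hU, h1⟩ := exists_eval_eq_zero (Polynomial.X ^ q - Polynomial.C D)
    (Polynomial.monic_X_pow_sub_C D hq) (b := 1) one_ne_zero (by simpa [Polynomial.derivative_X_pow] using hq)
    (by simp [X_dvd_iff, hD])
  refine ⟨U, ?_, by simpa [sub_eq_zero] using hU⟩
  simpa [X_dvd_iff, sub_eq_zero] using h1

/-- `q`-th roots with constant coefficient `1` are determined modulo `X ^ n`. -/
theorem PowerSeries.X_pow_dvd_sub_of_pow [CharZero K] {q : ℕ} (hq : q ≠ 0) {U V : K⟦X⟧} {n : ℕ}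
    (hU : constantCoeff U = 1) (hV : constantCoeff V = 1)
    (h : (X : K⟦X⟧) ^ n ∣ U ^ q - V ^ q) : (X : K⟦X⟧) ^ n ∣ U - V :=
  X_pow_dvd_sub_of_eval (Polynomial.X ^ q) (by simp [X_dvd_iff, hU, hV])
    (by simpa [Polynomial.derivative_X_pow, hV] using hq) (by simpa using h)

/-- Triangular expansion of a power series in terms of a family of `X ^ j * W j`. -/
theorem PowerSeries.exists_X_pow_dvd_sub_sum {W : ℕ → K⟦X⟧} (hW : ∀ j, constantCoeff (W j) = 1)
    (T : K⟦X⟧) : ∃ c : ℕ → K, ∀ n,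
      (X : K⟦X⟧) ^ n ∣ T - ∑ j ∈ Finset.range n, C (c j) * X ^ j * W j := by
  have key (n : ℕ) (S : K⟦X⟧) (h : (X : K⟦X⟧) ^ n ∣ T - S) :
      (X : K⟦X⟧) ^ (n + 1) ∣ T - (S + C (coeff n (T - S)) * X ^ n * W n) := by
    obtain ⟨g, hg⟩ := h
    rw [← sub_sub, hg, mul_comm (C _), mul_assoc, ← mul_sub, pow_succ]
    refine mul_dvd_mul_left _ (X_dvd_iff.2 ?_)
    simp [hW, coeff_X_pow_mul']
  let S : ℕ → K⟦X⟧ := fun n ↦ Nat.rec 0 (fun n s ↦ s + C (coeff n (T - s)) * X ^ n * W n) n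
  refine ⟨fun n ↦ coeff n (T - S n), fun n ↦ ?_⟩
  have hS (n : ℕ) : S n = ∑ j ∈ Finset.range n, C (coeff j (T - S j)) * X ^ j * W j := by
    induction n with
    | zero => rfl
    | succ n ih => rw [Finset.sum_range_succ, ← ih]
  rw [← hS]
  induction n with
  | zero => simp
  | succ n ih => exact key n _ ih

/-- Uniqueness of triangular expansions. -/
theorem PowerSeries.eq_zero_of_X_pow_dvd_sum {W : ℕ → K⟦X⟧} (hW : ∀ j, constantCoeff (W j) = 1)
    {c : ℕ → K} {n : ℕ} (h : (X : K⟦X⟧) ^ n ∣ ∑ j ∈ Finset.range n, C (c j) * X ^ j * W j) :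
    ∀ j < n, c j = 0 := by
  induction n with
  | zero => simp
  | succ n ih =>
    have h0 : ∀ j < n, c j = 0 := ih <| by
      rw [Finset.sum_range_succ] at h
      exact (dvd_add_left ((dvd_mul_left _ _).mul_right _)).1 ((pow_dvd_pow X n.le_succ).trans h)
    rw [Finset.sum_range_succ, Finset.sum_eq_zero (fun j hj ↦ by simp [h0 j (by simpa using hj)]),
      zero_add] at h
    have hn := X_pow_dvd_iff.1 h n n.lt_succ_self
    rw [mul_comm (C _), mul_assoc, coeff_X_pow_mul'] at hn
    intro j hj
    obtain hj | rfl := Nat.lt_succ_iff_lt_or_eq.1 hj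
    · exact h0 j hj
    · simpa [hW] using hn

/-- An approximate solution of `∑ j ≤ p + r, c j * X ^ j * U ^ (p + r - j) = U ^ r` can be
improved to an exact one. -/
theorem PowerSeries.exists_sum_pow_eq [CharZero K] {p r : ℕ} (hp : p ≠ 0) {c : ℕ → K}
    (hc : c 0 = 1) {U : K⟦X⟧} (hU : constantCoeff U = 1)
    (h : (X : K⟦X⟧) ^ (p + r + 1) ∣
      U ^ r - ∑ j ∈ Finset.range (p + r + 1), C (c j) * X ^ j * U ^ (p + r - j)) :
    ∃ V : K⟦X⟧, (X : K⟦X⟧) ^ (p + r + 1) ∣ V - U ∧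
      ∑ j ∈ Finset.range (p + r + 1), C (c j) * X ^ j * V ^ (p + r - j) = V ^ r := by
  set Q : Polynomial K⟦X⟧ := ∑ j ∈ Finset.range (p + r),
    Polynomial.C (C (c (j + 1)) * X ^ (j + 1)) * Polynomial.X ^ (p + r - (j + 1)) with hQ
  set P : Polynomial K⟦X⟧ := Polynomial.X ^ (p + r) + (Q - Polynomial.X ^ r) with hPdef
  have heval (V : K⟦X⟧) : P.eval V =
      ∑ j ∈ Finset.range (p + r + 1), C (c j) * X ^ j * V ^ (p + r - j) - V ^ r := by
    rw [Finset.sum_range_succ']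
    simp [hPdef, hQ, Polynomial.eval_finsetSum, hc]
    ring
  have hmonic : P.Monic := by
    refine Polynomial.monic_X_pow_add (lt_of_le_of_lt (Polynomial.degree_sub_le _ _) ?_)
    refine max_lt ?_ (by rw [Polynomial.degree_X_pow]; exact_mod_cast (by omega : r < p + r))
    refine (Polynomial.degree_lt_iff_coeff_zero _ _).2 fun m hm ↦ ?_
    rw [hQ, Polynomial.finsetSum_coeff]
    refine Finset.sum_eq_zero fun j hj ↦ ?_
    rw [Polynomial.coeff_C_mul_X_pow, if_neg]
    have := Finset.mem_range.1 hj
    omega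
  have hder : constantCoeff (P.derivative.eval U) = p := by
    simp only [hPdef, hQ, Polynomial.derivative_add, Polynomial.derivative_sub,
      Polynomial.derivative_sum, Polynomial.derivative_C_mul, Polynomial.derivative_X_pow]
    simp [-map_mul, -map_pow, Polynomial.eval_finsetSum]
    simp [hU]
  obtain ⟨V, hV, hVU⟩ := exists_eval_eq_zero P hmonic (p + r).succ_ne_zero
    (by rw [hder]; exact_mod_cast hp) (b := U) (by rw [heval, ← dvd_neg, neg_sub]; exact h)
  exact ⟨V, hVU, sub_eq_zero.1 ((heval V).symm.trans hV)⟩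

end FormalPowerSeries

section KPTimes

theorem sum_Icc_eq_sum_range_sub {M : Type*} [AddCommMonoid M] (N : ℕ) (f : ℕ → M) :
    ∑ k ∈ Finset.Icc 1 N, f k = ∑ j ∈ Finset.range N, f (N - j) := by
  refine Finset.sum_nbij' (fun k ↦ N - k) (fun j ↦ N - j) ?_ ?_ ?_ ?_ ?_ <;>
    intro a ha <;> simp only [Finset.mem_Icc, Finset.mem_range] at ha ⊢
  all_goals first | omega | (congr 1; omega)

theorem zz_ne_zero : zz ≠ 0 := by
  simp [zz]

theorem zz_zpow (n : ℤ) : zz ^ n = HahnSeries.single (-n) (1 : ℂ) := by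
  rw [← neg_neg n, ← inv_zpow', zz, HahnSeries.inv_single, RatFunc.single_zpow]
  simp

theorem ofPowerSeries_X_eq_inv_zz : HahnSeries.ofPowerSeries ℤ ℂ PowerSeries.X = zz⁻¹ := by
  simp [zz]

theorem coeff_zz_pow_mul (n : ℕ) (f : LS) (m : ℤ) : (zz ^ n * f).coeff m = f.coeff (m + n) := by
  rw [← zpow_natCast, zz_zpow, HahnSeries.coeff_single_mul, one_mul, sub_neg_eq_add]

theorem compEq_sum_iff (s : Finset ℕ) (c : ℕ → ℂ) (e : ℕ → ℤ) (g H : LS) :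
    CompEq (∑ k ∈ s, c k • zz ^ e k) g H ↔ H = ∑ k ∈ s, c k • g ^ e k := by
  have key (n : ℤ) : ∑ᶠ m : ℤ, (∑ k ∈ s, c k • zz ^ e k : LS).coeff m * (g ^ (-m)).coeff n =
      (∑ k ∈ s, c k • g ^ e k : LS).coeff n := by
    have hzero (k : ℕ) (m : ℤ) (hm : m ≠ -e k) :
        (c k • zz ^ e k : LS).coeff m * (g ^ (-m)).coeff n = 0 := by
      simp [zz_zpow, HahnSeries.coeff_single_of_ne hm]
    simp only [HahnSeries.coeff_sum, Finset.sum_mul]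
    rw [finsum_sum_comm]
    · refine Finset.sum_congr rfl fun k _ ↦ ?_
      rw [finsum_eq_single _ (-e k) (hzero k)]
      simp [zz_zpow]
    · exact fun k _ ↦ (Set.finite_singleton (-e k)).subset fun m hm ↦
        by_contra fun hne ↦ hm (hzero k m hne)
  simp only [CompEq, key, HahnSeries.ext_iff, funext_iff]

theorem constantCoeff_onePlusP (y : ℕ → ℂ) : PowerSeries.constantCoeff (onePlusP y) = 1 := by
  simp [onePlusP]

theorem onePlusP_coeff {U : PowerSeries ℂ} (hU : PowerSeries.constantCoeff U = 1) :
    onePlusP (fun n ↦ PowerSeries.coeff n U) = U := by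
  ext n
  by_cases hn : n = 0 <;> simp [onePlusP, hn, hU]

theorem zSeries_ne_zero (y : ℕ → ℂ) : zSeries y ≠ 0 := by
  refine mul_ne_zero zz_ne_zero ?_
  rw [onePlusL, map_ne_zero_iff _ HahnSeries.ofPowerSeries_injective]
  intro h
  simpa [h] using constantCoeff_onePlusP y

/-- The truncated power series `X ^ q * F₁`. -/
def truncFone (p q : ℕ) (t : ℕ → ℂ) : PowerSeries ℂ :=
  ∑ j ∈ Finset.range (p + q),
    PowerSeries.C (((p + q - j : ℕ) : ℂ) * t (p + q - j) / p) * PowerSeries.X ^ j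

theorem Fone_eq (p q : ℕ) (t : ℕ → ℂ) :
    Fone p q t = zz ^ q * HahnSeries.ofPowerSeries ℤ ℂ (truncFone p q t) := by
  rw [Fone, sum_Icc_eq_sum_range_sub, truncFone, map_sum, Finset.mul_sum]
  refine Finset.sum_congr rfl fun j hj ↦ ?_
  have hj := Finset.mem_range.1 hj
  rw [map_mul, map_pow, ofPowerSeries_X_eq_inv_zz, HahnSeries.ofPowerSeries_C,
    ← HahnSeries.C_mul_eq_smul, mul_left_comm, inv_pow, ← zpow_natCast, ← zpow_natCast, ← zpow_neg,
    ← zpow_add₀ zz_ne_zero]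
  congr 2
  omega

theorem constantCoeff_truncFone {p q : ℕ} (hp : 0 < p) {t : ℕ → ℂ}
    (ht : t (p + q) = (p : ℂ) / ((p : ℂ) + (q : ℂ))) :
    PowerSeries.constantCoeff (truncFone p q t) = 1 := by
  have hp0 : (p : ℂ) ≠ 0 := by exact_mod_cast hp.ne'
  have hpq0 : (p : ℂ) + q ≠ 0 := by exact_mod_cast (by omega : p + q ≠ 0)
  rw [truncFone, map_sum, Finset.sum_eq_single_of_mem 0 (by simp; omega)
    (fun j _ hj ↦ by simp [hj])]
  simp [ht]
  field_simp

theorem exists_gauge_iff (p q : ℕ) (t y : ℕ → ℂ) :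
    (∃ R : LS, GaugeAt p R ∧ zSeries y ^ q = Fone p q t + R) ↔
      PowerSeries.X ^ (p + q) ∣ onePlusP y ^ q - truncFone p q t := by
  have hdiff : zSeries y ^ q - Fone p q t =
      zz ^ q * HahnSeries.ofPowerSeries ℤ ℂ (onePlusP y ^ q - truncFone p q t) := by
    rw [Fone_eq, zSeries, onePlusL, map_sub, map_pow]
    ring
  have hex : (∃ R : LS, GaugeAt p R ∧ zSeries y ^ q = Fone p q t + R) ↔
      GaugeAt p (zSeries y ^ q - Fone p q t) := by
    constructor
    · rintro ⟨R, hR, h⟩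
      rwa [h, add_sub_cancel_left]
    · exact fun h ↦ ⟨_, h, by ring⟩
  rw [hex, hdiff, PowerSeries.X_pow_dvd_iff]
  constructor
  · intro h m hm
    have := h (m - q) (by omega)
    rwa [coeff_zz_pow_mul, sub_add_cancel, LaurentSeries.coeff_coe_powerSeries] at this
  · intro h m hm
    rw [coeff_zz_pow_mul]
    rcases lt_or_ge (m + q) 0 with hneg | hpos
    · rw [PowerSeries.coeff_coe, if_pos hneg]
    · obtain ⟨n, hn⟩ := Int.eq_ofNat_of_zero_le hpos
      rw [hn, LaurentSeries.coeff_coe_powerSeries]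
      exact h n (by omega)

theorem compEq_Ftwo_iff (p r : ℕ) (th y : ℕ → ℂ) :
    CompEq (Ftwo p (r + 1) th) (zSeries y) (zz ^ p) ↔
      ∑ j ∈ Finset.range (p + r + 1), PowerSeries.C
        (-(((p + r + 1 - j : ℕ) : ℂ) * th (p + r + 1 - j) / (r + 1 : ℕ))) * PowerSeries.X ^ j *
          onePlusP y ^ (p + r - j) = onePlusP y ^ r := by
  have hF : Ftwo p (r + 1) th = ∑ k ∈ Finset.Icc 1 (p + r + 1),
      (-((k : ℂ) * th k / (r + 1 : ℕ))) • zz ^ ((k : ℤ) - ((r + 1 : ℕ) : ℤ)) := by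
    rw [Ftwo, ← Finset.sum_neg_distrib]
    exact Finset.sum_congr rfl fun _ _ ↦ (neg_smul _ _).symm
  have hmul : zSeries y ^ r * (zz⁻¹) ^ (p + r) ≠ 0 :=
    mul_ne_zero (pow_ne_zero _ (zSeries_ne_zero y)) (pow_ne_zero _ (inv_ne_zero zz_ne_zero))
  rw [hF, compEq_sum_iff, ← mul_left_inj' hmul, sum_Icc_eq_sum_range_sub, Finset.sum_mul,
    ← (HahnSeries.ofPowerSeries_injective (Γ := ℤ)).eq_iff, eq_comm, map_sum]
  have hz (n : ℕ) : zz ^ n * zz⁻¹ ^ n = 1 := by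
    rw [← mul_pow, mul_inv_cancel₀ zz_ne_zero, one_pow]
  refine Eq.congr (Finset.sum_congr rfl fun j hj ↦ ?_) ?_
  · have hj := Finset.mem_range.1 hj
    have hexp : (((p + r + 1 - j : ℕ) : ℤ) - ((r + 1 : ℕ) : ℤ)) + (r : ℕ) = (p + r - j : ℕ) := by
      omega
    rw [map_mul, map_mul, map_pow, map_pow, ofPowerSeries_X_eq_inv_zz, HahnSeries.ofPowerSeries_C,
      ← HahnSeries.C_mul_eq_smul, mul_assoc, ← mul_assoc (_ ^ (_ : ℤ)), ← zpow_natCast _ r,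
      ← zpow_add₀ (zSeries_ne_zero y), hexp, zpow_natCast, zSeries, mul_pow, mul_assoc, onePlusL]
    have hsplit : zz⁻¹ ^ (p + r) = zz⁻¹ ^ (p + r - j) * zz⁻¹ ^ j := by
      rw [← pow_add, Nat.sub_add_cancel (Nat.le_of_lt_succ hj)]
    rw [hsplit]
    linear_combination HahnSeries.C
      (-(((p + r + 1 - j : ℕ) : ℂ) * th (p + r + 1 - j) / (r + 1 : ℕ))) * zz⁻¹ ^ j * HahnSeries.ofPowerSeries ℤ ℂ (onePlusP y) ^ (p + r - j) *
      hz (p + r - j)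
  · rw [zSeries, onePlusL, map_pow, mul_pow]
    linear_combination HahnSeries.ofPowerSeries ℤ ℂ (onePlusP y) ^ r * hz (p + r)

end KPTimes

theorem statement10 (p q : ℕ) (hp : 0 < p) (hq : 0 < q) (hpq : Nat.Coprime p q)
    (t : ℕ → ℂ) (ht : t (p + q) = (p : ℂ) / ((p : ℂ) + (q : ℂ))) :
    ∃ th : ℕ → ℂ, th (p + q) = -(q : ℂ) / ((p : ℂ) + (q : ℂ)) ∧
      (∃ (R : LS) (y : ℕ → ℂ), GaugeAt p R ∧ zSeries y ^ q = Fone p q t + R ∧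
        CompEq (Ftwo p q th) (zSeries y) (zz ^ p)) ∧
      ∀ th' : ℕ → ℂ, th' (p + q) = -(q : ℂ) / ((p : ℂ) + (q : ℂ)) →
        (∃ (R : LS) (y : ℕ → ℂ), GaugeAt p R ∧ zSeries y ^ q = Fone p q t + R ∧
          CompEq (Ftwo p q th') (zSeries y) (zz ^ p)) →
        ∀ k, 1 ≤ k → k ≤ p + q - 1 → th' k = th k := by
  obtain ⟨r, rfl⟩ : ∃ r, q = r + 1 := ⟨q - 1, by omega⟩
  obtain ⟨U, hU, hUD⟩ := PowerSeries.exists_pow_eq hq.ne' (constantCoeff_truncFone hp ht)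
  have hW (j : ℕ) : PowerSeries.constantCoeff (U ^ (p + r - j)) = 1 := by simp [hU]
  obtain ⟨c, hc⟩ := PowerSeries.exists_X_pow_dvd_sub_sum hW (U ^ r)
  have hc0 : c 0 = 1 := by
    have := hc 1
    rw [pow_one, PowerSeries.X_dvd_iff] at this
    exact (sub_eq_zero.1 (by simpa [hU] using this)).symm
  set th : ℕ → ℂ := fun k ↦ -((r + 1 : ℕ) : ℂ) * c (p + r + 1 - k) / k with hth
  have hthc (j : ℕ) (hj : j < p + r + 1) :
      -(((p + r + 1 - j : ℕ) : ℂ) * th (p + r + 1 - j) / (r + 1 : ℕ)) = c j := by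
    have hk : ((p + r + 1 - j : ℕ) : ℂ) ≠ 0 := by exact_mod_cast (by omega : p + r + 1 - j ≠ 0)
    simp only [hth, show p + r + 1 - (p + r + 1 - j) = j by omega]
    field_simp
  refine ⟨th, ?_, ?_, ?_⟩
  · simp [hth, ← add_assoc, hc0]
  · obtain ⟨V, hVU, hV⟩ := PowerSeries.exists_sum_pow_eq hp.ne' hc0 hU (hc (p + r + 1))
    have hV1 : PowerSeries.constantCoeff V = 1 := by
      have := PowerSeries.X_dvd_iff.1 ((dvd_pow_self _ (p + r).succ_ne_zero).trans hVU)
      simpa [hU, sub_eq_zero] using this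
    obtain ⟨R, hR, hRV⟩ :=
      (exists_gauge_iff p (r + 1) t fun n ↦ PowerSeries.coeff n V).2 <| by
        rw [onePlusP_coeff hV1, ← hUD]
        exact hVU.trans (sub_dvd_pow_sub_pow V U (r + 1))
    refine ⟨R, _, hR, hRV, (compEq_Ftwo_iff p r th _).2 ?_⟩
    rw [onePlusP_coeff hV1, ← hV]
    exact Finset.sum_congr rfl fun j hj ↦ by rw [hthc j (Finset.mem_range.1 hj)]
  · rintro th' - ⟨R, y, hR, hRy, hcomp⟩ k hk1 hk2
    set V := onePlusP y with hVdef
    have hVU : PowerSeries.X ^ (p + r + 1) ∣ U - V := by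
      refine PowerSeries.X_pow_dvd_sub_of_pow hq.ne' hU (constantCoeff_onePlusP y) ?_
      rw [hUD, ← dvd_neg, neg_sub]
      exact (exists_gauge_iff p (r + 1) t y).1 ⟨R, hR, hRy⟩
    rw [compEq_Ftwo_iff] at hcomp
    set c' : ℕ → ℂ := fun j ↦
      -(((p + r + 1 - j : ℕ) : ℂ) * th' (p + r + 1 - j) / (r + 1 : ℕ)) with hc'
    have hdvd : PowerSeries.X ^ (p + r + 1) ∣ ∑ j ∈ Finset.range (p + r + 1),
        PowerSeries.C (c' j - c j) * PowerSeries.X ^ j * U ^ (p + r - j) := by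
      have h1 : PowerSeries.X ^ (p + r + 1) ∣ ∑ j ∈ Finset.range (p + r + 1),
          PowerSeries.C (c' j) * PowerSeries.X ^ j * (U ^ (p + r - j) - V ^ (p + r - j)) :=
        Finset.dvd_sum fun j _ ↦ (hVU.trans (sub_dvd_pow_sub_pow _ _ _)).mul_left _
      have h2 := (hVU.trans (sub_dvd_pow_sub_pow U V r))
      convert (h1.sub h2).add (hc (p + r + 1)) using 1
      simp only [mul_sub, map_sub, sub_mul, Finset.sum_sub_distrib]
      rw [hcomp]
      ring
    have hj := sub_eq_zero.1 <| PowerSeries.eq_zero_of_X_pow_dvd_sum hW hdvd (p + r + 1 - k)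
      (by omega)
    have hk0 : (k : ℂ) ≠ 0 := by exact_mod_cast (by omega : k ≠ 0)
    simp only [hc', show p + r + 1 - (p + r + 1 - k) = k by omega] at hj
    simp only [hth, ← hj]
    field_simp
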